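/- A k-linear map T : k(Γ;F) → k(Δ;G) is Σ-preserving if and only if there exists a function M : Γ×Δ → k with the following properties: (a) for every F0 ∈ F there exists G0 ∈ G such that (i) for all γ ∈ F0 and δ ∈ Δ, if M(γ,δ) ≠ 0 then δ ∈ G0, and (ii) for every δ ∈ Δ the set {γ ∈ F0 : M(γ,δ) ≠ 0} is finite; (b) for every f ∈ k(Γ;F) and δ ∈ Δ, (T f)(δ) = Σ_{γ ∈ supp f} f(γ)·M(γ,δ) (a finite sum by (ii)). Moreover M is uniquely determined by T, namely M(γ,δ) = T(e_γ)(δ) where e_γ ∈ k(Γ;F) is the indicator function of γ. (This is the k-points instance of the identification Hom(k[Γ,F], k[Δ,G]) ≅ k[Γ×Δ, (F→G)].) -/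

import Mathlib

open Function

structure Borno (Γ : Type) where
  sets : Set (Set Γ)
  finite_mem : ∀ s : Set Γ, s.Finite → s ∈ sets
  subset_mem : ∀ s t : Set Γ, s ⊆ t → t ∈ sets → s ∈ sets
  union_mem : ∀ s t : Set Γ, s ∈ sets → t ∈ sets → s ∪ t ∈ sets

def Borno.orth {Γ : Type} (F : Borno Γ) : Borno Γ where
  sets := {S | ∀ A ∈ F.sets, (S ∩ A).Finite}
  finite_mem := fun _ hs A _ => hs.inter_of_left A
  subset_mem := fun s t hst ht A hA =>
    (ht A hA).subset (Set.inter_subset_inter hst (subset_refl A))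
  union_mem := fun s t hs ht A hA => by
    rw [Set.union_inter_distrib_right]
    exact (hs A hA).union (ht A hA)

def bspace (k : Type) [Field k] {Γ : Type} (F : Borno Γ) : Submodule k (Γ → k) where
  carrier := {f | Function.support f ∈ F.sets}
  add_mem' := fun {f} {g} hf hg =>
    F.subset_mem _ _ (Function.support_add f g) (F.union_mem _ _ hf hg)
  zero_mem' := F.finite_mem _ (by simp)
  smul_mem' := fun c f hf =>
    F.subset_mem _ _ (Function.support_const_smul_subset c f) hf

def SummableFam {k : Type} [Field k] {Γ : Type} (F : Borno Γ) {ι : Type} (f : ι → Γ → k) : Prop :=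
  (⋃ i, Function.support (f i)) ∈ F.sets ∧ ∀ γ : Γ, {i | f i γ ≠ 0}.Finite

noncomputable def famSum {k Γ ι : Type} [Field k] (f : ι → Γ → k) : Γ → k :=
  fun γ => ∑ᶠ i, f i γ

theorem famSum_mem {k : Type} [Field k] {Γ ι : Type} (F : Borno Γ) (f : ι → Γ → k)
    (hf : SummableFam F f) : famSum f ∈ bspace k F := by
  refine F.subset_mem _ _ ?_ hf.1
  intro γ hγ
  by_contra hns
  simp only [Set.mem_iUnion, Function.mem_support] at hns
  push_neg at hns
  exact hγ (by simpa [famSum] using finsum_eq_zero_of_forall_eq_zero hns)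

noncomputable def sumElem {k : Type} [Field k] {Γ ι : Type} (F : Borno Γ)
    (f : ι → bspace k F) (hf : SummableFam F (fun i => (f i : Γ → k))) : bspace k F :=
  ⟨famSum (fun i => (f i : Γ → k)), famSum_mem F _ hf⟩

def SigmaPreserving {k : Type} [Field k] {Γ Δ : Type} {F : Borno Γ} {G : Borno Δ}
    (T : bspace k F →ₗ[k] bspace k G) : Prop :=
  ∀ (ι : Type) (f : ι → bspace k F) (hf : SummableFam F (fun i => (f i : Γ → k))),
    ∃ hg : SummableFam G (fun i => (T (f i) : Δ → k)),
      T (sumElem F f hf) = sumElem G (fun i => T (f i)) hg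

noncomputable def pairing {k Γ : Type} [Field k] (f g : Γ → k) : k := ∑ᶠ γ, f γ * g γ

noncomputable def indic {k : Type} [Field k] {Γ : Type} (F : Borno Γ) (γ : Γ) : bspace k F :=
  ⟨Set.indicator {γ} (fun _ => (1 : k)),
    F.subset_mem _ _ Set.support_indicator_subset
      (F.finite_mem _ (Set.finite_singleton γ))⟩

theorem indic_apply_self {k : Type} [Field k] {Γ : Type} (F : Borno Γ) (γ : Γ) :
    (indic F γ : bspace k F).1 γ = 1 := by
  simp [indic]

theorem indic_apply_of_ne {k : Type} [Field k] {Γ : Type} (F : Borno Γ) {γ γ' : Γ}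
    (h : γ' ≠ γ) : (indic F γ : bspace k F).1 γ' = 0 := by
  simp [indic, h]

theorem eq_of_indic_apply_ne_zero {k : Type} [Field k] {Γ : Type} (F : Borno Γ) {γ γ' : Γ}
    (h : (indic F γ : bspace k F).1 γ' ≠ 0) : γ' = γ := by
  by_contra hne
  exact h (indic_apply_of_ne F hne)

theorem summableFam_indic {k : Type} [Field k] {Γ : Type} (F : Borno Γ) {F0 : Set Γ}
    (hF0 : F0 ∈ F.sets) : SummableFam F (fun γ : F0 => (indic F (γ : Γ) : bspace k F).1) := by
  refine ⟨F.subset_mem _ _ (Set.iUnion_subset ?_) hF0, fun γ => ?_⟩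
  · intro γ γ' hγ'
    rw [eq_of_indic_apply_ne_zero F hγ']
    exact γ.2
  · refine Set.Subsingleton.finite fun a ha b hb => Subtype.ext ?_
    exact (eq_of_indic_apply_ne_zero F ha).symm.trans (eq_of_indic_apply_ne_zero F hb)

theorem summableFam_smul_indic {k : Type} [Field k] {Γ : Type} (F : Borno Γ)
    (f : bspace k F) :
    SummableFam F (fun γ => ((f : Γ → k) γ • indic F γ : bspace k F).1) := by
  refine ⟨F.subset_mem _ _ (Set.iUnion_subset ?_) f.2, fun γ => ?_⟩
  · intro γ γ' hγ'
    have h : (f : Γ → k) γ * (indic F γ : bspace k F).1 γ' ≠ 0 := hγ'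
    rw [eq_of_indic_apply_ne_zero F (right_ne_zero_of_mul h)]
    exact left_ne_zero_of_mul h
  · refine (Set.finite_singleton γ).subset fun a ha => ?_
    have h : (f : Γ → k) a * (indic F a : bspace k F).1 γ ≠ 0 := ha
    exact (eq_of_indic_apply_ne_zero F (right_ne_zero_of_mul h)).symm

theorem sumElem_smul_indic {k : Type} [Field k] {Γ : Type} (F : Borno Γ) (f : bspace k F) :
    sumElem F (fun γ => (f : Γ → k) γ • indic F γ) (summableFam_smul_indic F f) = f := by
  ext γ
  change ∑ᶠ a, (f : Γ → k) a * (indic F a : bspace k F).1 γ = (f : Γ → k) γ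
  rw [finsum_eq_single _ γ fun a ha => by rw [indic_apply_of_ne F ha.symm, mul_zero],
    indic_apply_self, mul_one]

theorem finsum_indic_mul {k : Type} [Field k] {Γ : Type} (F : Borno Γ) (γ : Γ) (m : Γ → k) :
    ∑ᶠ a, (indic F γ : bspace k F).1 a * m a = m γ := by
  rw [finsum_eq_single _ γ fun a ha => by rw [indic_apply_of_ne F ha, zero_mul],
    indic_apply_self, one_mul]

theorem SigmaPreserving.exists_matrix_bound {k : Type} [Field k] {Γ Δ : Type} {F : Borno Γ}
    {G : Borno Δ} {T : bspace k F →ₗ[k] bspace k G} (hT : SigmaPreserving T) {F0 : Set Γ}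
    (hF0 : F0 ∈ F.sets) :
    ∃ G0 ∈ G.sets, (∀ γ ∈ F0, ∀ δ : Δ, (T (indic F γ) : Δ → k) δ ≠ 0 → δ ∈ G0) ∧
      ∀ δ : Δ, {γ ∈ F0 | (T (indic F γ) : Δ → k) δ ≠ 0}.Finite := by
  obtain ⟨hg, -⟩ := hT F0 (fun γ => indic F (γ : Γ)) (summableFam_indic F hF0)
  refine ⟨_, hg.1, fun γ hγ δ h => Set.mem_iUnion.2 ⟨⟨γ, hγ⟩, h⟩, fun δ => ?_⟩
  refine ((hg.2 δ).image Subtype.val).subset ?_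
  rintro γ ⟨hγ, h⟩
  exact ⟨⟨γ, hγ⟩, h, rfl⟩

theorem SigmaPreserving.apply_eq_finsum {k : Type} [Field k] {Γ Δ : Type} {F : Borno Γ}
    {G : Borno Δ} {T : bspace k F →ₗ[k] bspace k G} (hT : SigmaPreserving T)
    (f : bspace k F) (δ : Δ) :
    (T f : Δ → k) δ = ∑ᶠ γ, (f : Γ → k) γ * (T (indic F γ) : Δ → k) δ := by
  obtain ⟨_, h⟩ := hT Γ (fun γ => (f : Γ → k) γ • indic F γ) (summableFam_smul_indic F f)
  rw [sumElem_smul_indic] at h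
  have h' : (T f : Δ → k) δ = ∑ᶠ γ, (T ((f : Γ → k) γ • indic F γ) : Δ → k) δ :=
    congrFun (congrArg Subtype.val h) δ
  simpa using h'

theorem exists_ne_zero_of_finsum_ne_zero {α M : Type*} [AddCommMonoid M] {f : α → M}
    (h : ∑ᶠ a, f a ≠ 0) : ∃ a, f a ≠ 0 := by
  by_contra! h'
  exact h (finsum_eq_zero_of_forall_eq_zero h')

theorem finsum_finsum_mul_comm {k Γ ι : Type} [Field k] (f : ι → Γ → k) (m : Γ → k)
    (hf : ∀ γ, {i | f i γ ≠ 0}.Finite) (hm : {γ ∈ ⋃ i, support (f i) | m γ ≠ 0}.Finite) :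
    ∑ᶠ γ, (∑ᶠ i, f i γ) * m γ = ∑ᶠ i, ∑ᶠ γ, f i γ * m γ := by
  classical
  set S := hm.toFinset
  have hS : ∀ i γ, f i γ * m γ ≠ 0 → γ ∈ S := fun i γ h => hm.mem_toFinset.2
    ⟨Set.mem_iUnion.2 ⟨i, left_ne_zero_of_mul h⟩, right_ne_zero_of_mul h⟩
  have hrow : ∀ i, ∑ᶠ γ, f i γ * m γ = ∑ γ ∈ S, f i γ * m γ := fun i =>
    finsum_eq_sum_of_support_subset _ fun γ h => hS i γ h
  have hcol : ∀ γ, (∑ᶠ i, f i γ) * m γ = ∑ᶠ i, f i γ * m γ := fun γ => finsum_mul _ (m γ)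
  simp only [hrow, hcol]
  rw [finsum_sum_comm S _ fun γ _ => (hf γ).subset fun i h => left_ne_zero_of_mul h]
  refine finsum_eq_sum_of_support_subset _ fun γ h => ?_
  obtain ⟨i, hi⟩ := exists_ne_zero_of_finsum_ne_zero h
  exact hS i γ hi

theorem sigmaPreserving_of_matrix {k : Type} [Field k] {Γ Δ : Type} {F : Borno Γ}
    {G : Borno Δ} {T : bspace k F →ₗ[k] bspace k G} (M : Γ × Δ → k)
    (hM : ∀ F0 ∈ F.sets, ∃ G0 ∈ G.sets,
      (∀ γ ∈ F0, ∀ δ : Δ, M (γ, δ) ≠ 0 → δ ∈ G0) ∧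
      (∀ δ : Δ, {γ ∈ F0 | M (γ, δ) ≠ 0}.Finite))
    (hT : ∀ (f : bspace k F) (δ : Δ),
      (T f : Δ → k) δ = ∑ᶠ γ : Γ, (f : Γ → k) γ * M (γ, δ)) :
    SigmaPreserving T := by
  intro ι f hf
  obtain ⟨G0, hG0, hsub, hfin⟩ := hM _ hf.1
  have hne : ∀ i δ, (T (f i) : Δ → k) δ ≠ 0 →
      ∃ γ, (f i : Γ → k) γ ≠ 0 ∧ M (γ, δ) ≠ 0 := by
    intro i δ h
    rw [hT] at h
    obtain ⟨γ, hγ⟩ := exists_ne_zero_of_finsum_ne_zero h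
    exact ⟨γ, left_ne_zero_of_mul hγ, right_ne_zero_of_mul hγ⟩
  refine ⟨⟨G.subset_mem _ _ (Set.iUnion_subset fun i δ h => ?_) hG0, fun δ => ?_⟩, ?_⟩
  · obtain ⟨γ, hγ, hMγ⟩ := hne i δ h
    exact hsub γ (Set.mem_iUnion.2 ⟨i, hγ⟩) δ hMγ
  · refine ((hfin δ).biUnion fun γ _ => hf.2 γ).subset fun i h => ?_
    obtain ⟨γ, hγ, hMγ⟩ := hne i δ h
    exact Set.mem_biUnion (⟨Set.mem_iUnion.2 ⟨i, hγ⟩, hMγ⟩ : γ ∈ {γ ∈ _ | _}) hγ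
  · ext δ
    rw [hT]
    change ∑ᶠ γ, (∑ᶠ i, (f i : Γ → k) γ) * M (γ, δ) = ∑ᶠ i, (T (f i) : Δ → k) δ
    simp only [hT]
    exact finsum_finsum_mul_comm _ (fun γ => M (γ, δ)) hf.2 (hfin δ)

/-- `T : k(Γ;F) → k(Δ;G)` is Σ-preserving iff it is given by a "matrix"
`M : Γ×Δ → k` such that (a) for every `F0 ∈ F` there is `G0 ∈ G` with (i) `M(γ,δ) ≠ 0` for
`γ ∈ F0` only when `δ ∈ G0` and (ii) for each `δ` only finitely many `γ ∈ F0` have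
`M(γ,δ) ≠ 0`; and (b) `(T f)(δ) = Σ_γ f(γ)·M(γ,δ)`. Moreover `M` is uniquely determined by
`T`, namely `M(γ,δ) = T(e_γ)(δ)` where `e_γ` is the indicator of `γ`. -/
theorem stmt17 {k : Type} [Field k] {Γ Δ : Type} (F : Borno Γ) (G : Borno Δ)
    (T : bspace k F →ₗ[k] bspace k G) :
    (SigmaPreserving T ↔
      ∃ M : Γ × Δ → k,
        (∀ F0 ∈ F.sets, ∃ G0 ∈ G.sets,
          (∀ γ ∈ F0, ∀ δ : Δ, M (γ, δ) ≠ 0 → δ ∈ G0) ∧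
          (∀ δ : Δ, {γ ∈ F0 | M (γ, δ) ≠ 0}.Finite)) ∧
        (∀ (f : bspace k F) (δ : Δ),
          (T f : Δ → k) δ = ∑ᶠ γ : Γ, (f : Γ → k) γ * M (γ, δ))) ∧
    (∀ M : Γ × Δ → k,
      (∀ F0 ∈ F.sets, ∃ G0 ∈ G.sets,
        (∀ γ ∈ F0, ∀ δ : Δ, M (γ, δ) ≠ 0 → δ ∈ G0) ∧
        (∀ δ : Δ, {γ ∈ F0 | M (γ, δ) ≠ 0}.Finite)) →
      (∀ (f : bspace k F) (δ : Δ),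
        (T f : Δ → k) δ = ∑ᶠ γ : Γ, (f : Γ → k) γ * M (γ, δ)) →
      ∀ (γ : Γ) (δ : Δ), M (γ, δ) = (T (indic F γ) : Δ → k) δ) := by
  refine ⟨⟨fun hT => ⟨fun p => (T (indic F p.1) : Δ → k) p.2,
    fun _ hF0 => hT.exists_matrix_bound hF0, hT.apply_eq_finsum⟩,
    fun ⟨M, hM, hT⟩ => sigmaPreserving_of_matrix M hM hT⟩, fun M _ hT γ δ => ?_⟩
  rw [hT, finsum_indic_mul F γ fun a => M (a, δ)]
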